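/- Soundness of finite state expansion (Theorem 1, solution form): let ℛ be a finite set of reactions, each reaction r having reactant vector ρ_r ∈ ℕ^𝒮, product vector π_r ∈ ℕ^𝒮, and propensity f_r : ℕ^𝒮 → ℝ≥0 well-defined for ρ_r, and fix an observation bound O ∈ ℕ^𝒮. Suppose P̂ assigns to each time t ∈ ℝ and each single-tracked state ⟦o⟧ + ξ a real value P̂_t(⟦o⟧ + ξ) (extended by zero to any formal expanded state that has a negative component or is not single-tracked), such that each coordinate t ↦ P̂_t(⟦o⟧ + ξ) is differentiable and satisfies the master equation of the expanded network: d/dt P̂_t(z) = Σ_{r ∈ ℛ} Σ_{ε ≤ O} [ f_{r,ε}(z + (⟦ε⟧ + η_{r,ε}) − (⟦ε'_{r,ε}⟧ + ψ_{r,ε}))·P̂_t(z + (⟦ε⟧ + η_{r,ε}) − (⟦ε'_{r,ε}⟧ + ψ_{r,ε})) − f_{r,ε}(z)·P̂_t(z) ] at every single-tracked state z, where η_{r,ε} = ρ_r ⊖ ε, ψ_{r,ε} = ((ε ⊖ ρ_r) + π_r) ⊖ O, ε'_{r,ε} = O ∧ ((ε ⊖ ρ_r) + π_r), and both f_{r,ε}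 and P̂_t are taken to be zero on any formal state with a negative component. Then for every σ ∈ ℕ^𝒮 the aggregate Q_t(σ) := Σ_{o ≤ O, o ≤ σ} P̂_t(⟦o⟧ + (σ − o)) is differentiable in t and satisfies the master equation of the original network: d/dt Q_t(σ) = Σ_{r ∈ ℛ} [ f_r(σ + ρ_r − π_r)·Q_t(σ + ρ_r − π_r) − f_r(σ)·Q_t(σ) ], where terms in which σ + ρ_r − π_r has a negative component are omitted. -/

import Mathlib

open scoped NNReal

attribute [local instance] Classical.propDecidable

namespace FSE

variable {𝒮 : Type*} [Fintype 𝒮] [DecidableEq 𝒮]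

/-- Tracked states: population vectors bounded by the observation bound `O`. -/
def Tracked (O : 𝒮 → ℕ) : Type _ := {o : 𝒮 → ℕ // o ≤ O}

instance (O : 𝒮 → ℕ) : Fintype (Tracked O) :=
  Fintype.subtype (Finset.Iic O) fun _ => Finset.mem_Iic

/-- Expanded species: original (buffer) species `𝒮` plus one auxiliary species
`⟦o⟧` for every tracked state `o ≤ O`. -/
def ExpSpecies (O : 𝒮 → ℕ) : Type _ := 𝒮 ⊕ Tracked O

/-- The single-tracked expanded state `⟦o⟧ + ξ`: it assigns `1` to the tracked
species `⟦o⟧`, `0` to every other tracked species, and `ξ S` to each buffer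
species `S ∈ 𝒮` (viewed as an integer-valued formal state). -/
noncomputable def singleTracked (O : 𝒮 → ℕ) (o : Tracked O) (ξ : 𝒮 → ℕ) : ExpSpecies O → ℤ
  | Sum.inl S => ξ S
  | Sum.inr p => if p = o then 1 else 0

/-- The expanded propensity `f_ε` of a reaction with propensity `f`, conditioned
on tracked state `⟦ε⟧`: `f_ε(z) = z(⟦ε⟧) · f(ε + z|𝒮)`, extended by zero to any
formal state with a negative component. -/
noncomputable def expProp (O : 𝒮 → ℕ) (f : (𝒮 → ℕ) → ℝ≥0) (ε : Tracked O)
    (z : ExpSpecies O → ℤ) : ℝ :=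
  if ∀ x, 0 ≤ z x then
    (z (Sum.inr ε) : ℝ) * (f (ε.1 + fun S => (z (Sum.inl S)).toNat) : ℝ)
  else 0

/-- The change-of-state vector `(⟦ε⟧ + η) − (⟦ε'⟧ + ψ)` of the expanded reaction
`⟦ε⟧ + η → ⟦ε'⟧ + ψ` obtained from a reaction `ρ → π` at tracked state `ε`,
where `η = ρ ⊖ ε`, `ψ = ((ε ⊖ ρ) + π) ⊖ O` and `ε' = O ⊓ ((ε ⊖ ρ) + π)`:
adding it to a target state gives the corresponding source state. -/
noncomputable def jump (O ρ π : 𝒮 → ℕ) (ε : Tracked O) : ExpSpecies O → ℤ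
  | Sum.inl S => ((ρ - ε.1) S : ℤ) - ((((ε.1 - ρ) + π) - O) S : ℤ)
  | Sum.inr p => (if p = ε then 1 else 0)
      - (if p = (⟨O ⊓ ((ε.1 - ρ) + π), inf_le_left⟩ : Tracked O) then 1 else 0)

/-- The master-equation drift `D̂(z)` of the expanded network at a formal
expanded state `z`, with `P̂` extended by zero off the single-tracked states. -/
noncomputable def expDrift (O : 𝒮 → ℕ) {R : Type*} [Fintype R]
    (ρ π : R → 𝒮 → ℕ) (f : R → (𝒮 → ℕ) → ℝ≥0)
    (Phat : (ExpSpecies O → ℤ) → ℝ) (z : ExpSpecies O → ℤ) : ℝ :=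
  ∑ r : R, ∑ ε : Tracked O,
    (expProp O (f r) ε (z + jump O (ρ r) (π r) ε)
          * Phat (z + jump O (ρ r) (π r) ε)
      - expProp O (f r) ε z * Phat z)

/-- The aggregate `Q(τ) = Σ_{o ≤ O, o ≤ τ} P̂(⟦o⟧ + (τ − o))` of a distribution
over the single-tracked expanded states. -/
noncomputable def aggregate (O : 𝒮 → ℕ) (Phat : (ExpSpecies O → ℤ) → ℝ)
    (τ : 𝒮 → ℕ) : ℝ :=
  ∑ o : Tracked O, if o.1 ≤ τ then Phat (singleTracked O o (τ - o.1)) else 0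

/-- The tracked target of an expanded reaction. -/
def tgt (O ρ π : 𝒮 → ℕ) (ε : Tracked O) : Tracked O :=
  ⟨O ⊓ ((ε.1 - ρ) + π), inf_le_left⟩

lemma expProp_single (O : 𝒮 → ℕ) (f : (𝒮 → ℕ) → ℝ≥0) (ε o : Tracked O) (ξ : 𝒮 → ℕ) :
    expProp O f ε (singleTracked O o ξ) = if ε = o then (f (o.1 + ξ) : ℝ) else 0 := by
  have h : ∀ x, 0 ≤ singleTracked O o ξ x := by
    rintro (S | p)
    · simp [singleTracked]
    · simp only [singleTracked]; split_ifs <;> simp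
  unfold expProp
  rw [if_pos h]
  by_cases he : ε = o
  · subst he; simp [singleTracked]
  · simp [singleTracked, he]

lemma expProp_jump_ne (O ρ π : 𝒮 → ℕ) (f : (𝒮 → ℕ) → ℝ≥0) (ε o : Tracked O) (ξ : 𝒮 → ℕ)
    (h : o ≠ tgt O ρ π ε) :
    expProp O f ε (singleTracked O o ξ + jump O ρ π ε) = 0 := by
  unfold expProp
  split_ifs with hn
  · have h1 := hn (Sum.inr (tgt O ρ π ε))
    by_cases he : ε = tgt O ρ π ε
    · have h2 : (singleTracked O o ξ + jump O ρ π ε) (Sum.inr ε) = 0 := by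
        have h3 : ε ≠ o := fun h' => h (h' ▸ he)
        change (if ε = o then (1:ℤ) else 0) +
          ((if ε = ε then 1 else 0) - (if ε = tgt O ρ π ε then 1 else 0)) = 0
        rw [if_neg h3, if_pos rfl, if_pos he]; rfl
      rw [h2]; simp
    · exfalso
      change 0 ≤ (if tgt O ρ π ε = o then (1:ℤ) else 0) +
          ((if tgt O ρ π ε = ε then 1 else 0) - (if tgt O ρ π ε = tgt O ρ π ε then 1 else 0)) at h1
      rw [if_neg (Ne.symm h), if_neg (Ne.symm he), if_pos rfl] at h1
      omega
  · rfl

lemma term_eq (O ρ π : 𝒮 → ℕ) (f : (𝒮 → ℕ) → ℝ≥0)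
    (hwd : ∀ σ : 𝒮 → ℕ, ¬ ρ ≤ σ → f σ = 0) (P : (ExpSpecies O → ℤ) → ℝ)
    (ε : Tracked O) (σ : 𝒮 → ℕ) :
    (if (tgt O ρ π ε).1 ≤ σ then
      expProp O f ε (singleTracked O (tgt O ρ π ε) (σ - (tgt O ρ π ε).1) + jump O ρ π ε) *
        P (singleTracked O (tgt O ρ π ε) (σ - (tgt O ρ π ε).1) + jump O ρ π ε) else 0) =
    if π ≤ σ + ρ then (f ((σ + ρ) - π) : ℝ) *
      (if ε.1 ≤ (σ + ρ) - π then P (singleTracked O ε (((σ + ρ) - π) - ε.1)) else 0) else 0 := by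
  have hT : ∀ S, (tgt O ρ π ε).1 S = min (O S) (ε.1 S - ρ S + π S) := fun S => rfl
  have hε : ∀ S, ε.1 S ≤ O S := ε.2
  have hinl : ∀ S, (singleTracked O (tgt O ρ π ε) (σ - (tgt O ρ π ε).1) + jump O ρ π ε)
      (Sum.inl S) = ((σ S - min (O S) (ε.1 S - ρ S + π S) : ℕ) : ℤ) +
        (((ρ S - ε.1 S : ℕ) : ℤ) - ((ε.1 S - ρ S + π S - O S : ℕ) : ℤ)) := fun S => rfl
  have hinr : ∀ p, (singleTracked O (tgt O ρ π ε) (σ - (tgt O ρ π ε).1) + jump O ρ π ε)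
      (Sum.inr p) = if p = ε then 1 else 0 := by
    intro p
    change (if p = tgt O ρ π ε then (1:ℤ) else 0) +
          ((if p = ε then 1 else 0) - (if p = tgt O ρ π ε then 1 else 0)) = _
    omega
  generalize singleTracked O (tgt O ρ π ε) (σ - (tgt O ρ π ε).1) + jump O ρ π ε = z at *
  by_cases h : (tgt O ρ π ε).1 ≤ σ ∧ ∀ S, 0 ≤ z (Sum.inl S)
  · obtain ⟨h1, h2⟩ := h
    have hπ : π ≤ σ + ρ := by
      intro S
      have a : (tgt O ρ π ε).1 S ≤ σ S := h1 S; have b := h2 S; have c := hε S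
      rw [hT] at a; rw [hinl] at b
      change π S ≤ σ S + ρ S
      rcases le_total (O S) (ε.1 S - ρ S + π S) with m | m
      · simp only [min_eq_left m] at *; omega
      · simp only [min_eq_right m] at *; omega
    have hτ : ε.1 ≤ σ + ρ - π := by
      intro S
      have a : (tgt O ρ π ε).1 S ≤ σ S := h1 S; have b := h2 S; have c := hε S
      rw [hT] at a; rw [hinl] at b
      change ε.1 S ≤ σ S + ρ S - π S
      rcases le_total (O S) (ε.1 S - ρ S + π S) with m | m
      · simp only [min_eq_left m] at *; omega
      · simp only [min_eq_right m] at *; omega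
    have hz : z = singleTracked O ε (σ + ρ - π - ε.1) := by
      funext x
      rcases x with S | p
      · have a : (tgt O ρ π ε).1 S ≤ σ S := h1 S; have b := h2 S; have c := hε S
        rw [hT] at a; rw [hinl] at b ⊢
        have d : π S ≤ σ S + ρ S := hπ S; have e : ε.1 S ≤ σ S + ρ S - π S := hτ S
        simp only [singleTracked, Pi.add_apply, Pi.sub_apply]
        rcases le_total (O S) (ε.1 S - ρ S + π S) with m | m
        · simp only [min_eq_left m] at *; omega
        · simp only [min_eq_right m] at *; omega
      · rw [hinr]; rfl
    rw [if_pos h1, if_pos hπ, if_pos hτ, hz, expProp_single, if_pos rfl, add_tsub_cancel_of_le hτ]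
  · have hl : (if (tgt O ρ π ε).1 ≤ σ then expProp O f ε z * P z else 0) = 0 := by
      split_ifs with h1
      · have : ¬ ∀ x, 0 ≤ z x := fun h' => h ⟨h1, fun S => h' _⟩
        unfold expProp
        rw [if_neg this, zero_mul]
      · rfl
    rw [hl]
    split_ifs with hπ hτ
    · have : ¬ ρ ≤ σ + ρ - π := by
        intro hρ
        apply h
        constructor
        · intro S
          have d : π S ≤ σ S + ρ S := hπ S; have e : ε.1 S ≤ σ S + ρ S - π S := hτ S; have g : ρ S ≤ σ S + ρ S - π S := hρ S
          change (tgt O ρ π ε).1 S ≤ σ S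
          rw [hT]
          rcases le_total (O S) (ε.1 S - ρ S + π S) with m | m
          · simp only [min_eq_left m] at *; omega
          · simp only [min_eq_right m] at *; omega
        · intro S
          have d : π S ≤ σ S + ρ S := hπ S; have e : ε.1 S ≤ σ S + ρ S - π S := hτ S; have g : ρ S ≤ σ S + ρ S - π S := hρ S; have c := hε S
          rw [hinl]
          rcases le_total (O S) (ε.1 S - ρ S + π S) with m | m
          · simp only [min_eq_left m] at *; omega
          · simp only [min_eq_right m] at *; omega
      rw [hwd _ this]; simp
    · simp
    · rfl

/-- **Soundness of finite state expansion (Theorem 1, solution form).** Let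
`ℛ` be a finite set of reactions with well-defined propensities and `O` an
observation bound. Suppose `P̂ t` assigns to each time `t` a real value on every
formal expanded state, vanishing on any state that is not single-tracked (in
particular on states with a negative component), and each coordinate
`t ↦ P̂ t (⟦o⟧ + ξ)` is differentiable with derivative given by the master
equation of the expanded network (the drift `D̂`). Then for every `σ` the
aggregate `Q t σ = Σ_{o ≤ O, o ≤ σ} P̂ t (⟦o⟧ + (σ − o))` is differentiable in
`t` and satisfies the master equation of the original network, terms in which
`σ + ρ r − π r` has a negative component (i.e. `π r ≤ σ + ρ r` fails) being
omitted. -/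
theorem fse_soundness {R : Type*} [Fintype R]
    (O : 𝒮 → ℕ) (ρ π : R → 𝒮 → ℕ) (f : R → (𝒮 → ℕ) → ℝ≥0)
    (hwd : ∀ r, ∀ σ : 𝒮 → ℕ, ¬ ρ r ≤ σ → f r σ = 0)
    (Phat : ℝ → (ExpSpecies O → ℤ) → ℝ)
    (hsupp : ∀ (t : ℝ) (z : ExpSpecies O → ℤ),
      (∀ (o : Tracked O) (ξ : 𝒮 → ℕ), z ≠ singleTracked O o ξ) → Phat t z = 0)
    (hODE : ∀ (t : ℝ) (o : Tracked O) (ξ : 𝒮 → ℕ),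
      HasDerivAt (fun s => Phat s (singleTracked O o ξ))
        (expDrift O ρ π f (Phat t) (singleTracked O o ξ)) t) :
    ∀ (t : ℝ) (σ : 𝒮 → ℕ),
      HasDerivAt (fun s => aggregate O (Phat s) σ)
        (∑ r : R,
          ((if π r ≤ σ + ρ r then
              (f r ((σ + ρ r) - π r) : ℝ) * aggregate O (Phat t) ((σ + ρ r) - π r)
            else 0)
            - (f r σ : ℝ) * aggregate O (Phat t) σ)) t := by
  intro t σ
  have hD : HasDerivAt (fun s => aggregate O (Phat s) σ)
      (∑ o : Tracked O, if o.1 ≤ σ then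
        expDrift O ρ π f (Phat t) (singleTracked O o (σ - o.1)) else 0) t := by
    unfold aggregate
    apply HasDerivAt.fun_sum
    intro o _
    split_ifs with h
    · exact hODE t o _
    · exact hasDerivAt_const _ _
  convert hD using 1
  have e1 : ∀ o : Tracked O, (if o.1 ≤ σ then
      expDrift O ρ π f (Phat t) (singleTracked O o (σ - o.1)) else 0) =
      ∑ r : R, ((∑ ε : Tracked O, if o.1 ≤ σ then
        expProp O (f r) ε (singleTracked O o (σ - o.1) + jump O (ρ r) (π r) ε)
          * Phat t (singleTracked O o (σ - o.1) + jump O (ρ r) (π r) ε) else 0)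
        - (f r σ : ℝ) * (if o.1 ≤ σ then Phat t (singleTracked O o (σ - o.1)) else 0)) := by
    intro o
    by_cases h : o.1 ≤ σ
    · simp only [if_pos h]
      unfold expDrift
      refine Finset.sum_congr rfl fun r _ => ?_
      rw [Finset.sum_sub_distrib]
      congr 1
      simp only [expProp_single]
      rw [add_tsub_cancel_of_le h, ← Finset.sum_mul]
      simp
    · simp [if_neg h]
  simp only [e1]
  rw [Finset.sum_comm]
  refine Finset.sum_congr rfl fun r _ => ?_
  rw [Finset.sum_sub_distrib, ← Finset.mul_sum]
  congr 1
  rw [Finset.sum_comm]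
  have e2 : ∀ ε : Tracked O, (∑ o : Tracked O, if o.1 ≤ σ then
        expProp O (f r) ε (singleTracked O o (σ - o.1) + jump O (ρ r) (π r) ε)
          * Phat t (singleTracked O o (σ - o.1) + jump O (ρ r) (π r) ε) else 0) =
      if π r ≤ σ + ρ r then (f r ((σ + ρ r) - π r) : ℝ) *
      (if ε.1 ≤ (σ + ρ r) - π r then
        Phat t (singleTracked O ε (((σ + ρ r) - π r) - ε.1)) else 0) else 0 := by
    intro ε
    rw [← term_eq O (ρ r) (π r) (f r) (hwd r) (Phat t) ε σ]
    apply Finset.sum_eq_single (tgt O (ρ r) (π r) ε)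
    · intro o _ ho
      rw [expProp_jump_ne _ _ _ _ _ _ _ ho]
      simp
    · intro h; exact absurd (Finset.mem_univ _) h
  simp only [e2]
  split_ifs with hπ
  · unfold aggregate
    rw [Finset.mul_sum]
  · simp

end FSE
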